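/- arXiv:2208.09182 — 2 statements merged into one kernel-verified Lean document; each statement's English description precedes it below -/
import Mathlib

section
/- Let T > 0, K ⊂ ℝ compact, D₁, D₂ : ℝ × ℝ → ℝ continuous, ψ : ℝ × ℝ → ℝ smooth (C²), π : ℝ × ℝ → ℝ continuous, and ρ : ℝ × ℝ → ℝ smooth (C²) with, for every t ∈ [0,T], the maps x ↦ ρ(x,t), x ↦ D₁(x,π(x,t))ρ(x,t), x ↦ D₂(x,π(x,t))ρ(x,t) smooth in x and supported in K. Assume: (i) ρ satisfies the Fokker–Planck–Kolmogorov equation ∂ρ/∂t = −∂/∂x(D₁(x,π)ρ) + ∂²/∂x²(D₂(x,π)ρ); and (ii) ψ satisfies the Hamilton–Jacobi–Bellman equation ∂ψ/∂t = (1/2)π² − D₁(x,π)·∂ψ/∂x − D₂(x,π)·∂²ψ/∂x² pointwise on ℝ × [0,T]. Then the total control cost admits the representation ∫₀ᵀ ∫_ℝ (1/2)π(x,t)²·ρ(x,t) dx dt = ∫_ℝ ψ(x,T)ρ(x,T) dx − ∫_ℝ ψ(x,0)ρ(x,0) dx. -/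
open MeasureTheory

/-- Integration by parts on the line against a compactly supported `C¹` function. -/
lemma integral_mul_deriv_of_hasCompactSupport {u v : ℝ → ℝ} (hu : ContDiff ℝ 1 u)
    (hv : ContDiff ℝ 1 v) (hvc : HasCompactSupport v) :
    ∫ x, u x * deriv v x = -∫ x, deriv u x * v x := by
  have hu' : Continuous (deriv u) := hu.continuous_deriv le_rfl
  have hv' : Continuous (deriv v) := hv.continuous_deriv le_rfl
  refine integral_mul_deriv_eq_deriv_mul_of_integrable
    (fun x _ => (hu.differentiable one_ne_zero x).hasDerivAt)
    (fun x _ => (hv.differentiable one_ne_zero x).hasDerivAt) ?_ ?_ ?_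
  · exact (hu.continuous.mul hv').integrable_of_hasCompactSupport hvc.deriv.mul_left
  · exact (hu'.mul hv.continuous).integrable_of_hasCompactSupport hvc.mul_left
  · exact (hu.continuous.mul hv.continuous).integrable_of_hasCompactSupport hvc.mul_left

/-- Duality between the generator `f ↦ a f' + b f''` and its adjoint `ρ ↦ -(aρ)' + (bρ)''`, stated
for the fluxes `F = aρ` and `G = bρ`. -/
lemma integrable_and_integral_adjoint_sub_generator_eq_zero {f F G : ℝ → ℝ} (hf : ContDiff ℝ 2 f)
    (hF : ContDiff ℝ 2 F) (hG : ContDiff ℝ 2 G)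
    (hFc : HasCompactSupport F) (hGc : HasCompactSupport G) :
    Integrable (fun x => f x * (-deriv F x + deriv (deriv G) x)
      - (F x * deriv f x + G x * deriv (deriv f) x)) ∧
    ∫ x, (f x * (-deriv F x + deriv (deriv G) x)
      - (F x * deriv f x + G x * deriv (deriv f) x)) = 0 := by
  have hf' : ContDiff ℝ 1 (deriv f) := hf.deriv'
  have hF' : ContDiff ℝ 1 (deriv F) := hF.deriv'
  have hG' : ContDiff ℝ 1 (deriv G) := hG.deriv'
  have hf1 : ContDiff ℝ 1 f := hf.of_le one_le_two
  have hG1 : ContDiff ℝ 1 G := hG.of_le one_le_two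
  have hF1 : ContDiff ℝ 1 F := hF.of_le one_le_two
  have e1 := integral_mul_deriv_of_hasCompactSupport hf1 hF1 hFc
  have e2 := integral_mul_deriv_of_hasCompactSupport hf1 hG' hGc.deriv
  have e3 := integral_mul_deriv_of_hasCompactSupport hf' hG1 hGc
  have i1 : Integrable fun x => f x * deriv F x :=
    (hf.continuous.mul hF'.continuous).integrable_of_hasCompactSupport hFc.deriv.mul_left
  have i2 : Integrable fun x => f x * deriv (deriv G) x :=
    (hf.continuous.mul (hG'.continuous_deriv le_rfl)).integrable_of_hasCompactSupport
      hGc.deriv.deriv.mul_left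
  have i3 : Integrable fun x => deriv f x * F x :=
    (hf'.continuous.mul hF.continuous).integrable_of_hasCompactSupport hFc.mul_left
  have i4 : Integrable fun x => deriv (deriv f) x * G x :=
    ((hf'.continuous_deriv le_rfl).mul hG.continuous).integrable_of_hasCompactSupport
      hGc.mul_left
  have heq : (fun x => f x * (-deriv F x + deriv (deriv G) x)
      - (F x * deriv f x + G x * deriv (deriv f) x))
      = fun x => (f x * deriv (deriv G) x - f x * deriv F x)
        - (deriv f x * F x + deriv (deriv f) x * G x) := by
    ext x; ring
  rw [heq]
  refine ⟨(i2.sub i1).sub (i3.add i4), ?_⟩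
  rw [integral_sub (by exact i2.sub i1) (by exact i3.add i4), integral_sub i2 i1,
    integral_add i3 i4]
  linarith

/-- If `g` is `C¹` in the plane and its time derivative vanishes for `x` outside a compact set,
the spatial integral of the time derivative integrates to the increment of the spatial integral. -/
lemma integral_integral_deriv_eq_sub {g : ℝ × ℝ → ℝ} (hg : ContDiff ℝ 1 g) {a b : ℝ}
    (hab : a ≤ b) {K : Set ℝ} (hK : IsCompact K)
    (hsupp : ∀ t ∈ Set.Icc a b, Function.support (fun x => g (x, t)) ⊆ K)
    (hderiv : ∀ t ∈ Set.Icc a b, Function.support (fun x => deriv (fun s => g (x, s)) t) ⊆ K) :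
    ∫ t in a..b, ∫ x, deriv (fun s => g (x, s)) t
      = (∫ x, g (x, b)) - ∫ x, g (x, a) := by
  have hd : ∀ x t, HasDerivAt (fun s => g (x, s)) (fderiv ℝ g (x, t) (0, 1)) t := fun x t =>
    (hg.differentiable one_ne_zero (x, t)).hasFDerivAt.comp_hasDerivAt t
      ((hasDerivAt_const t x).prodMk (hasDerivAt_id t))
  have hcont : Continuous fun p : ℝ × ℝ => deriv (fun s => g (p.1, s)) p.2 := by
    simp_rw [fun x t => (hd x t).deriv]
    exact (hg.continuous_fderiv one_ne_zero).clm_apply continuous_const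
  have hint : ∀ t ∈ Set.Icc a b, Integrable fun x => g (x, t) := fun t ht =>
    (hg.continuous.comp (by fun_prop : Continuous fun x : ℝ => (x, t)))
      |>.integrable_of_hasCompactSupport
        (HasCompactSupport.of_support_subset_isCompact hK (hsupp t ht))
  rw [← integral_sub (hint b ⟨hab, le_rfl⟩) (hint a ⟨le_rfl, hab⟩)]
  have hftc : ∀ x, g (x, b) - g (x, a) = ∫ t in a..b, deriv (fun s => g (x, s)) t := fun x =>
    (intervalIntegral.integral_eq_sub_of_hasDerivAt
      (fun t _ => (hd x t).differentiableAt.hasDerivAt)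
      ((hcont.comp (by fun_prop : Continuous fun t : ℝ => (x, t))).intervalIntegrable a b)).symm
  have hout : ∀ x ∉ K, g (x, b) - g (x, a) = 0 := fun x hx => by
    rw [Function.notMem_support.1 fun h => hx (hsupp b ⟨hab, le_rfl⟩ h),
      Function.notMem_support.1 fun h => hx (hsupp a ⟨le_rfl, hab⟩ h), sub_zero]
  rw [← setIntegral_eq_integral_of_forall_compl_eq_zero hout]
  simp_rw [hftc, intervalIntegral.integral_of_le hab]
  rw [integral_integral_swap (f := fun x t => deriv (fun s => g (x, s)) t)]
  · refine setIntegral_congr_fun measurableSet_Ioc fun t ht => ?_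
    exact (setIntegral_eq_integral_of_forall_compl_eq_zero fun x hx =>
      Function.notMem_support.1 fun h => hx (hderiv t (Set.Ioc_subset_Icc_self ht) h)).symm
  · rw [Measure.prod_restrict]
    exact (hcont.continuousOn.integrableOn_compact (hK.prod isCompact_Icc)).mono_set
      (Set.prod_mono_right Set.Ioc_subset_Icc_self)

/-- Cost representation implicit in the Lagrangian argument of Theorem 1:
if ρ satisfies the FPK equation and ψ satisfies the HJB equation, then the
total control cost equals the difference of the value function integrated
against the terminal and initial densities. -/
theorem stmt_5 (T : ℝ) (hT : 0 < T) (K : Set ℝ) (hK : IsCompact K)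
    (D₁ D₂ : ℝ × ℝ → ℝ) (hD₁ : Continuous D₁) (hD₂ : Continuous D₂)
    (ψ : ℝ × ℝ → ℝ) (hψ : ContDiff ℝ 2 ψ)
    (π : ℝ × ℝ → ℝ) (hπ : Continuous π)
    (ρ : ℝ × ℝ → ℝ) (hρ : ContDiff ℝ 2 ρ)
    (hsmooth₁ : ∀ t ∈ Set.Icc (0 : ℝ) T,
      ContDiff ℝ 2 (fun x => D₁ (x, π (x, t)) * ρ (x, t)))
    (hsmooth₂ : ∀ t ∈ Set.Icc (0 : ℝ) T,
      ContDiff ℝ 2 (fun x => D₂ (x, π (x, t)) * ρ (x, t)))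
    (hsuppρ : ∀ t ∈ Set.Icc (0 : ℝ) T, Function.support (fun x => ρ (x, t)) ⊆ K)
    (hsupp₁ : ∀ t ∈ Set.Icc (0 : ℝ) T,
      Function.support (fun x => D₁ (x, π (x, t)) * ρ (x, t)) ⊆ K)
    (hsupp₂ : ∀ t ∈ Set.Icc (0 : ℝ) T,
      Function.support (fun x => D₂ (x, π (x, t)) * ρ (x, t)) ⊆ K)
    -- (i) the Fokker–Planck–Kolmogorov equation
    (hFPK : ∀ x : ℝ, ∀ t ∈ Set.Icc (0 : ℝ) T,
      deriv (fun s => ρ (x, s)) t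
        = -(deriv (fun y => D₁ (y, π (y, t)) * ρ (y, t)) x)
          + deriv (deriv (fun y => D₂ (y, π (y, t)) * ρ (y, t))) x)
    -- (ii) the Hamilton–Jacobi–Bellman equation
    (hHJB : ∀ x : ℝ, ∀ t ∈ Set.Icc (0 : ℝ) T,
      deriv (fun s => ψ (x, s)) t
        = (1 / 2) * (π (x, t)) ^ 2
          - D₁ (x, π (x, t)) * deriv (fun y => ψ (y, t)) x
          - D₂ (x, π (x, t)) * deriv (deriv (fun y => ψ (y, t))) x) :
    (∫ t in (0 : ℝ)..T, ∫ x : ℝ, (1 / 2) * (π (x, t)) ^ 2 * ρ (x, t))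
      = (∫ x : ℝ, ψ (x, T) * ρ (x, T)) - ∫ x : ℝ, ψ (x, 0) * ρ (x, 0) := by
  have hprod : ∀ x t, deriv (fun s => ψ (x, s) * ρ (x, s)) t
      = deriv (fun s => ψ (x, s)) t * ρ (x, t) + ψ (x, t) * deriv (fun s => ρ (x, s)) t :=
    fun x t => deriv_fun_mul
      (((hψ.differentiable two_ne_zero).comp (by fun_prop :
        Differentiable ℝ fun s : ℝ => (x, s))) t)
      (((hρ.differentiable two_ne_zero).comp (by fun_prop :
        Differentiable ℝ fun s : ℝ => (x, s))) t)
  have hderiv_supp : ∀ f : ℝ → ℝ, Function.support f ⊆ K → Function.support (deriv f) ⊆ K :=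
    fun f hf => (support_deriv_subset).trans (closure_minimal hf hK.isClosed)
  rw [← integral_integral_deriv_eq_sub (g := fun p => ψ p * ρ p)
    ((hψ.mul hρ).of_le one_le_two) hT.le hK]
  · refine intervalIntegral.integral_congr fun t ht => ?_
    rw [Set.uIcc_of_le hT.le] at ht
    have hψt : ContDiff ℝ 2 fun x => ψ (x, t) := hψ.comp (by fun_prop)
    have hc {f : ℝ → ℝ} (hf : Function.support f ⊆ K) : HasCompactSupport f :=
      HasCompactSupport.of_support_subset_isCompact hK hf
    obtain ⟨hi, hibp⟩ := integrable_and_integral_adjoint_sub_generator_eq_zero hψt (hsmooth₁ t ht) (hsmooth₂ t ht)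
      (hc (hsupp₁ t ht)) (hc (hsupp₂ t ht))
    have hcost : Integrable fun x => (1 / 2) * (π (x, t)) ^ 2 * ρ (x, t) :=
      Continuous.integrable_of_hasCompactSupport
        (by have := hρ.continuous; fun_prop) (hc (hsuppρ t ht)).mul_left
    simp only [hprod]
    rw [← add_zero (∫ x, (1 / 2) * (π (x, t)) ^ 2 * ρ (x, t)), ← hibp, ← integral_add hcost hi]
    congr 1 with x
    rw [hFPK x t ht, hHJB x t ht]
    ring
  · exact fun t ht => (Function.support_mul_subset_right _ _).trans (hsuppρ t ht)
  · intro t ht x hx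
    by_contra hxK
    refine hx ?_
    have h0 {f : ℝ → ℝ} (hf : Function.support f ⊆ K) : f x = 0 :=
      Function.notMem_support.1 fun h => hxK (hf h)
    simp only [hprod, hFPK x t ht]
    rw [h0 (hsuppρ t ht), h0 (hderiv_supp _ (hsupp₁ t ht)),
      h0 (hderiv_supp _ (hderiv_supp _ (hsupp₂ t ht)))]
    simp
end

section
/- Let T > 0, K ⊂ ℝ compact, D₁, D₂ : ℝ × ℝ → ℝ continuous, and ψ : ℝ × ℝ → ℝ smooth (C²). Assume ψ satisfies the Hamilton–Jacobi–Bellman inequality with pointwise global minimization: for every (x,t) ∈ ℝ × [0,T] and every u ∈ ℝ, (1/2)u² − D₁(x,u)·∂ψ/∂x(x,t) − D₂(x,u)·∂²ψ/∂x²(x,t) ≥ ∂ψ/∂t(x,t). Then for every feasible pair (ρ, π), i.e., π : ℝ × ℝ → ℝ continuous and ρ : ℝ × ℝ → ℝ smooth (C²) nonnegative with, for every t ∈ [0,T], x ↦ ρ(x,t), x ↦ D₁(x,π(x,t))ρ(x,t), x ↦ D₂(x,π(x,t))ρ(x,t) smooth in x and supported in K, satisfying ∂ρ/∂t = −∂/∂x(D₁(x,π)ρ)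 + ∂²/∂x²(D₂(x,π)ρ), the cost is bounded below: ∫₀ᵀ ∫_ℝ (1/2)π(x,t)²·ρ(x,t) dx dt ≥ ∫_ℝ ψ(x,T)ρ(x,T) dx − ∫_ℝ ψ(x,0)ρ(x,0) dx. -/
open MeasureTheory

open Filter Topology

theorem hasDerivAt_snd_of_contDiff {f : ℝ × ℝ → ℝ} (hf : ContDiff ℝ 2 f) (x t : ℝ) :
    HasDerivAt (fun s => f (x, s)) (fderiv ℝ f (x, t) (0, 1)) t :=
  ((hf.differentiable (by norm_num)) (x, t)).hasFDerivAt.comp_hasDerivAt t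
    ((hasDerivAt_const t x).prodMk (hasDerivAt_id t))

theorem continuous_deriv_snd_of_contDiff {f : ℝ × ℝ → ℝ} (hf : ContDiff ℝ 2 f) :
    Continuous fun p : ℝ × ℝ => deriv (fun s => f (p.1, s)) p.2 := by
  have h : (fun p : ℝ × ℝ => deriv (fun s => f (p.1, s)) p.2) =
      fun p => fderiv ℝ f p (0, 1) :=
    funext fun p => (hasDerivAt_snd_of_contDiff hf p.1 p.2).deriv
  rw [h]
  exact (hf.continuous_fderiv (by norm_num)).clm_apply continuous_const

theorem contDiff_one_deriv_of_contDiff_two {f : ℝ → ℝ} (hf : ContDiff ℝ 2 f) :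
    ContDiff ℝ 1 (deriv f) :=
  (contDiff_succ_iff_deriv.1 (show ContDiff ℝ (1 + 1) f by
    rw [one_add_one_eq_two]; exact hf)).2.2

/-- Integration by parts against the one-dimensional Fokker–Planck operator, for fluxes vanishing
near both endpoints. -/
theorem integral_mul_fokkerPlanck {f A B : ℝ → ℝ} (hf : ContDiff ℝ 2 f) (hA : ContDiff ℝ 2 A)
    (hB : ContDiff ℝ 2 B) {a b : ℝ} (hAa : A a = 0) (hAb : A b = 0)
    (hBa : B =ᶠ[𝓝 a] fun _ => 0) (hBb : B =ᶠ[𝓝 b] fun _ => 0) :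
    ∫ x in a..b, f x * (-(deriv A x) + deriv (deriv B) x) =
      ∫ x in a..b, (deriv f x * A x + deriv (deriv f) x * B x) := by
  have hf' := contDiff_one_deriv_of_contDiff_two hf
  have hA' := contDiff_one_deriv_of_contDiff_two hA
  have hB' := contDiff_one_deriv_of_contDiff_two hB
  have hf'' := hf'.continuous_deriv le_rfl
  have hB'' := hB'.continuous_deriv le_rfl
  have cf := hf.continuous
  have cA := hA.continuous
  have cB := hB.continuous
  have cf' := hf'.continuous
  have cA' := hA'.continuous
  have cl : Continuous fun x => f x * (-(deriv A x) + deriv (deriv B) x) := by fun_prop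
  have cr : Continuous fun x => deriv f x * A x + deriv (deriv f) x * B x := by fun_prop
  rw [← sub_eq_zero, ← intervalIntegral.integral_sub (cl.intervalIntegrable _ _)
    (cr.intervalIntegrable _ _)]
  have key : ∀ x ∈ Set.uIcc a b,
      HasDerivAt (fun x => -(f x * A x) + f x * deriv B x - deriv f x * B x)
        (f x * (-(deriv A x) + deriv (deriv B) x)
          - (deriv f x * A x + deriv (deriv f) x * B x)) x := by
    intro x _
    have d1 := (hf.differentiable (by norm_num) x).hasDerivAt
    have d2 := (hA.differentiable (by norm_num) x).hasDerivAt
    have d3 := (hB.differentiable (by norm_num) x).hasDerivAt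
    have d4 := (hf'.differentiable (by norm_num) x).hasDerivAt
    have d5 := (hB'.differentiable (by norm_num) x).hasDerivAt
    refine (((d1.fun_mul d2).fun_neg.fun_add (d1.fun_mul d5)).fun_sub
      (d4.fun_mul d3)).congr_deriv ?_
    ring
  rw [intervalIntegral.integral_eq_sub_of_hasDerivAt key ((cl.sub cr).intervalIntegrable _ _)]
  have ea : deriv B a = 0 := by rw [hBa.deriv_eq]; simp
  have eb : deriv B b = 0 := by rw [hBb.deriv_eq]; simp
  simp [hAa, hAb, hBa.eq_of_nhds, hBb.eq_of_nhds, ea, eb]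

/-- Verification (sufficiency) half of the Lagrangian argument of Theorem 1:
if ψ satisfies the HJB inequality with pointwise global minimization, then the
cost of every feasible pair (ρ, π) is bounded below by the difference of ψ
integrated against the terminal and initial densities. -/
theorem stmt_6 (T : ℝ) (hT : 0 < T) (K : Set ℝ) (hK : IsCompact K)
    (D₁ D₂ : ℝ × ℝ → ℝ) (hD₁ : Continuous D₁) (hD₂ : Continuous D₂)
    (ψ : ℝ × ℝ → ℝ) (hψ : ContDiff ℝ 2 ψ)
    -- the HJB inequality with pointwise global minimization
    (hHJB : ∀ x : ℝ, ∀ t ∈ Set.Icc (0 : ℝ) T, ∀ u : ℝ,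
      (1 / 2) * u ^ 2
        - D₁ (x, u) * deriv (fun y => ψ (y, t)) x
        - D₂ (x, u) * deriv (deriv (fun y => ψ (y, t))) x
      ≥ deriv (fun s => ψ (x, s)) t) :
    ∀ π ρ : ℝ × ℝ → ℝ, Continuous π → ContDiff ℝ 2 ρ → (∀ p, 0 ≤ ρ p) →
    (∀ t ∈ Set.Icc (0 : ℝ) T,
      ContDiff ℝ 2 (fun x => D₁ (x, π (x, t)) * ρ (x, t))) →
    (∀ t ∈ Set.Icc (0 : ℝ) T,
      ContDiff ℝ 2 (fun x => D₂ (x, π (x, t)) * ρ (x, t))) →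
    (∀ t ∈ Set.Icc (0 : ℝ) T, Function.support (fun x => ρ (x, t)) ⊆ K) →
    (∀ t ∈ Set.Icc (0 : ℝ) T,
      Function.support (fun x => D₁ (x, π (x, t)) * ρ (x, t)) ⊆ K) →
    (∀ t ∈ Set.Icc (0 : ℝ) T,
      Function.support (fun x => D₂ (x, π (x, t)) * ρ (x, t)) ⊆ K) →
    -- the Fokker–Planck–Kolmogorov equation
    (∀ x : ℝ, ∀ t ∈ Set.Icc (0 : ℝ) T,
      deriv (fun s => ρ (x, s)) t
        = -(deriv (fun y => D₁ (y, π (y, t)) * ρ (y, t)) x)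
          + deriv (deriv (fun y => D₂ (y, π (y, t)) * ρ (y, t))) x) →
    (∫ t in (0 : ℝ)..T, ∫ x : ℝ, (1 / 2) * (π (x, t)) ^ 2 * ρ (x, t))
      ≥ (∫ x : ℝ, ψ (x, T) * ρ (x, T)) - ∫ x : ℝ, ψ (x, 0) * ρ (x, 0) := by
  intro π ρ hπ hρ hρ0 hA hB hsρ hsA hsB hFPK
  obtain ⟨a, b, hab⟩ : ∃ a b : ℝ, K ⊆ Set.Ioo a b := by
    obtain ⟨R, hR⟩ := hK.isBounded.subset_ball 0
    exact ⟨0 - R, 0 + R, by rwa [← Real.ball_eq_Ioo]⟩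
  wlog hle : a ≤ b generalizing a b
  · exact this 0 0 (hab.trans (by rw [Set.Ioo_eq_empty fun h => hle h.le]; simp)) le_rfl
  have haK : a ∉ K := fun h => lt_irrefl _ (hab h).1
  have hbK : b ∉ K := fun h => lt_irrefl _ (hab h).2
  have vanish : ∀ {f : ℝ → ℝ}, Function.support f ⊆ K → ∀ x ∉ K, f =ᶠ[𝓝 x] fun _ => 0 := by
    intro f hf x hx
    filter_upwards [hK.isClosed.isOpen_compl.mem_nhds hx] with y hy
    exact Function.notMem_support.1 fun h => hy (hf h)
  have restrict : ∀ (g : ℝ → ℝ), ∀ t ∈ Set.Icc (0 : ℝ) T,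
      ∫ x, g x * ρ (x, t) = ∫ x in a..b, g x * ρ (x, t) := by
    intro g t ht
    refine (intervalIntegral.integral_eq_integral_of_support_subset ?_).symm
    exact (Function.support_mul_subset_right _ _).trans
      ((hsρ t ht).trans (hab.trans Set.Ioo_subset_Ioc_self))
  have cψ := hψ.continuous
  have cρ := hρ.continuous
  have cψt := continuous_deriv_snd_of_contDiff hψ
  have cρt := continuous_deriv_snd_of_contDiff hρ
  set G : ℝ × ℝ → ℝ := fun p => deriv (fun s => ψ (p.1, s)) p.2 * ρ p
    + ψ p * deriv (fun s => ρ (p.1, s)) p.2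
  have cG : Continuous G := (cψt.mul cρ).add (cψ.mul cρt)
  have ftc : ∀ x, ∫ t in (0 : ℝ)..T, G (x, t) = ψ (x, T) * ρ (x, T) - ψ (x, 0) * ρ (x, 0) := by
    intro x
    refine intervalIntegral.integral_eq_sub_of_hasDerivAt
      (f := fun t => ψ (x, t) * ρ (x, t)) (fun t _ => ?_)
      ((cG.comp (by fun_prop : Continuous fun t : ℝ => (x, t))).intervalIntegrable _ _)
    exact (hasDerivAt_snd_of_contDiff hψ x t).differentiableAt.hasDerivAt.fun_mul
      (hasDerivAt_snd_of_contDiff hρ x t).differentiableAt.hasDerivAt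
  have endpoints : (∫ x : ℝ, ψ (x, T) * ρ (x, T)) - ∫ x : ℝ, ψ (x, 0) * ρ (x, 0)
      = ∫ t in (0 : ℝ)..T, ∫ x in a..b, G (x, t) := by
    rw [restrict _ T ⟨hT.le, le_rfl⟩, restrict _ 0 ⟨le_rfl, hT.le⟩,
      ← intervalIntegral.integral_sub (Continuous.intervalIntegrable (by fun_prop) _ _)
        (Continuous.intervalIntegrable (by fun_prop) _ _)]
    simp_rw [← ftc]
    simp only [intervalIntegral.integral_of_le hle, intervalIntegral.integral_of_le hT.le]
    refine integral_integral_swap (f := fun x t => G (x, t)) ?_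
    rw [Measure.prod_restrict, ← Measure.volume_eq_prod]
    exact (cG.continuousOn.integrableOn_compact (isCompact_Icc.prod isCompact_Icc)).mono_set
      (Set.prod_mono Set.Ioc_subset_Icc_self Set.Ioc_subset_Icc_self)
  have cost : ∫ t in (0 : ℝ)..T, ∫ x : ℝ, (1 / 2) * (π (x, t)) ^ 2 * ρ (x, t)
      = ∫ t in (0 : ℝ)..T, ∫ x in a..b, (1 / 2) * (π (x, t)) ^ 2 * ρ (x, t) := by
    refine intervalIntegral.integral_congr fun t ht => ?_
    rw [Set.uIcc_of_le hT.le] at ht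
    exact restrict _ t ht
  rw [ge_iff_le, endpoints, cost]
  refine intervalIntegral.integral_mono_on hT.le
    (Continuous.intervalIntegrable ?_ _ _) (Continuous.intervalIntegrable ?_ _ _) fun t ht => ?_
  · exact intervalIntegral.continuous_parametric_intervalIntegral_of_continuous'
      (f := fun t x => G (x, t)) (cG.comp continuous_swap) a b
  · exact intervalIntegral.continuous_parametric_intervalIntegral_of_continuous'
      (f := fun t x => (1 / 2) * (π (x, t)) ^ 2 * ρ (x, t)) (by fun_prop) a b
  have hψx : ContDiff ℝ 2 fun y => ψ (y, t) := hψ.comp (contDiff_id.prodMk contDiff_const)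
  have cψx := (contDiff_one_deriv_of_contDiff_two hψx).continuous
  have cψxx := (contDiff_one_deriv_of_contDiff_two hψx).continuous_deriv le_rfl
  have parts := integral_mul_fokkerPlanck hψx (hA t ht) (hB t ht)
    (vanish (hsA t ht) a haK).eq_of_nhds (vanish (hsA t ht) b hbK).eq_of_nhds
    (vanish (hsB t ht) a haK) (vanish (hsB t ht) b hbK)
  have slice : Continuous fun x : ℝ => (x, t) := by fun_prop
  have c1 : Continuous fun x => deriv (fun s => ψ (x, s)) t * ρ (x, t) :=
    (cψt.mul cρ).comp slice
  have c2 : Continuous fun x => ψ (x, t) * deriv (fun s => ρ (x, s)) t :=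
    (cψ.mul cρt).comp slice
  have c3 : Continuous fun x => deriv (fun y => ψ (y, t)) x * (D₁ (x, π (x, t)) * ρ (x, t))
      + deriv (deriv fun y => ψ (y, t)) x * (D₂ (x, π (x, t)) * ρ (x, t)) := by
    fun_prop
  have split : ∫ x in a..b, G (x, t) = ∫ x in a..b, (deriv (fun s => ψ (x, s)) t * ρ (x, t)
      + (deriv (fun y => ψ (y, t)) x * (D₁ (x, π (x, t)) * ρ (x, t))
      + deriv (deriv fun y => ψ (y, t)) x * (D₂ (x, π (x, t)) * ρ (x, t)))) := by
    rw [intervalIntegral.integral_add (c1.intervalIntegrable _ _) (c3.intervalIntegrable _ _),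
      ← parts]
    simp_rw [← hFPK _ t ht]
    exact intervalIntegral.integral_add (c1.intervalIntegrable _ _) (c2.intervalIntegrable _ _)
  rw [split]
  refine intervalIntegral.integral_mono_on hle ((c1.add c3).intervalIntegrable _ _)
    (Continuous.intervalIntegrable (by fun_prop) _ _) fun x _ => ?_
  have := mul_le_mul_of_nonneg_right (hHJB x t ht (π (x, t))) (hρ0 (x, t))
  linarith
end
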